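/- Let A be a weighted pushdown system with state set Q and stack alphabet Γ, and let d = (|Q|·|Γ|)². For all states q₁, q₂ ∈ Q and stack symbols γ ∈ Γ: if the summary function value s(q₁,γ,q₂) lies in ℤ ∪ {−∞} (i.e., is not ω), then s(q₁,γ,q₂) = s_d(q₁,γ,q₂), where s_d is the stack-height-bounded summary function for bound d. -/

import Mathlib

open scoped BigOperators

namespace PDS

/-- Stack commands over a stack alphabet `Γ`. -/
inductive Com (Γ : Type) where
  | skip : Com Γ
  | pop : Com Γ
  | push (z : Γ) : Com Γ
  deriving DecidableEq

/-- Action of a stack command on a stack string (top of stack at the head). -/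
def Com.apply {Γ : Type} : Com Γ → List Γ → List Γ
  | .skip, α => α
  | .pop, α => α.tail
  | .push z, α => z :: α

/-- A transition (edge) of a pushdown system. -/
structure Edge (Q Γ : Type) where
  q1 : Q
  top : Γ
  q2 : Q
  com : Com Γ
  deriving DecidableEq

/-- A weighted pushdown system. -/
structure WPS (Q Γ : Type) where
  q0 : Q
  bot : Γ
  E : Set (Edge Q Γ)
  w : Edge Q Γ → ℤ
  no_push_bot : ∀ e ∈ E, e.com ≠ Com.push bot
  no_pop_bot : ∀ e ∈ E, e.top = bot → e.com ≠ Com.pop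

variable {Q Γ : Type}

/-- A configuration: stack string (top at head) together with a state. -/
abbrev Config (Q Γ : Type) := List Γ × Q

/-- A genuine configuration has a nonempty stack string. -/
def IsConfig (c : Config Q Γ) : Prop := c.1 ≠ []

/-- The initial configuration `(⊥, q₀)`. -/
def WPS.start (A : WPS Q Γ) : Config Q Γ := ([A.bot], A.q0)

/-- The configuration obtained by taking the edge `e` from `c`. -/
def next (c : Config Q Γ) (e : Edge Q Γ) : Config Q Γ := (e.com.apply c.1, e.q2)

/-- The edge `e` is enabled at configuration `c`. -/
def WPS.Enabled (A : WPS Q Γ) (c : Config Q Γ) (e : Edge Q Γ) : Prop :=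
  e ∈ A.E ∧ c.2 = e.q1 ∧ c.1.head? = some e.top

/-- Validity of a finite path, given by a start configuration and a list of edges. -/
def WPS.Valid (A : WPS Q Γ) : Config Q Γ → List (Edge Q Γ) → Prop
  | _, [] => True
  | c, e :: es => A.Enabled c e ∧ A.Valid (next c e) es

/-- Last configuration of the finite path `(c, es)`. -/
def endc (c : Config Q Γ) (es : List (Edge Q Γ)) : Config Q Γ := es.foldl next c

/-- The list of configurations along the finite path `(c, es)`. -/
def trace (c : Config Q Γ) (es : List (Edge Q Γ)) : List (Config Q Γ) :=
  List.scanl next c es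

/-- Total weight of a finite path. -/
def WPS.wt (A : WPS Q Γ) (es : List (Edge Q Γ)) : ℤ := (es.map A.w).sum

/-- Stack height of a configuration. -/
def height (c : Config Q Γ) : ℕ := c.1.length

/-- Stack height of a finite path: maximal stack height along it. -/
def SH (c : Config Q Γ) (es : List (Edge Q Γ)) : ℕ :=
  ((trace c es).map height).foldr max 0

/-- Additional stack height of a finite path. -/
def ASH (c : Config Q Γ) (es : List (Edge Q Γ)) : ℕ :=
  SH c es - max (height c) (height (endc c es))

/-- The first configuration of the path is a local minima: its stack string is a
prefix (here: suffix of the list, since the top is at the head) of all stack strings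
along the path. -/
def FirstMin (c : Config Q Γ) (es : List (Edge Q Γ)) : Prop :=
  ∀ c' ∈ trace c es, c.1 <:+ c'.1

/-- The edge sequence obtained from `u ++ p₁ ++ v ++ p₂ ++ x` by repeating `p₁` and
`p₂` each `j` times in place. -/
def pumped (u p₁ v p₂ x : List (Edge Q Γ)) (j : ℕ) : List (Edge Q Γ) :=
  u ++ (List.replicate j p₁).flatten ++ v ++ (List.replicate j p₂).flatten ++ x

/-- `(p₁, p₂)` is a pumpable pair of paths for the path `(c, es)`. -/
def WPS.PumpablePair (A : WPS Q Γ) (c : Config Q Γ) (es p₁ p₂ : List (Edge Q Γ)) : Prop :=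
  p₁ ≠ [] ∧ p₂ ≠ [] ∧
    ∃ u v x, es = u ++ p₁ ++ v ++ p₂ ++ x ∧
      ∀ j : ℕ, A.Valid c (pumped u p₁ v p₂ x j)

/-- The path `(c, es)` has a pumpable pair of paths. -/
def WPS.HasPumpablePair (A : WPS Q Γ) (c : Config Q Γ) (es : List (Edge Q Γ)) : Prop :=
  ∃ p₁ p₂, A.PumpablePair c es p₁ p₂

/-- `(c, es)` is a good cycle. -/
def WPS.GoodCycle (A : WPS Q Γ) (c : Config Q Γ) (es : List (Edge Q Γ)) : Prop :=
  A.Valid c es ∧ 0 < A.wt es ∧ FirstMin c es ∧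
    (endc c es).2 = c.2 ∧ (endc c es).1.head? = c.1.head?

/-- `A` has a good cycle reachable from the configuration `c`. -/
def WPS.ReachableGoodCycleFrom (A : WPS Q Γ) (c : Config Q Γ) : Prop :=
  ∃ es₀ es, A.Valid c es₀ ∧ A.GoodCycle (endc c es₀) es

/-- `A` has a good cycle (at some configuration). -/
def WPS.HasGoodCycle (A : WPS Q Γ) : Prop :=
  ∃ c es, IsConfig c ∧ A.GoodCycle c es

/-- The finite path `(c, es)` contains a good cycle. -/
def ContainsGoodCycle (A : WPS Q Γ) (c : Config Q Γ) (es : List (Edge Q Γ)) : Prop :=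
  ∃ es₁ es₂, es = es₁ ++ es₂ ∧ A.GoodCycle (endc c es₁) es₂

/-- Configurations along an infinite path given by an infinite edge sequence. -/
def confs (c : Config Q Γ) (f : ℕ → Edge Q Γ) : ℕ → Config Q Γ
  | 0 => c
  | n + 1 => next (confs c f n) (f n)

/-- Validity of the infinite path `(c, f)`. -/
def WPS.ValidInf (A : WPS Q Γ) (c : Config Q Γ) (f : ℕ → Edge Q Γ) : Prop :=
  ∀ n, A.Enabled (confs c f n) (f n)

/-- Average weight of the prefix of length `n+1` of an infinite path. -/
noncomputable def avgPref (A : WPS Q Γ) (f : ℕ → Edge Q Γ) (n : ℕ) : ℝ :=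
  (∑ i ∈ Finset.range (n + 1), (A.w (f i) : ℝ)) / (n + 1)

/-- Limit-sup of the averages along an infinite path. -/
noncomputable def LimSupAvg (A : WPS Q Γ) (f : ℕ → Edge Q Γ) : ℝ :=
  Filter.limsup (avgPref A f) Filter.atTop

/-- Limit-inf of the averages along an infinite path. -/
noncomputable def LimInfAvg (A : WPS Q Γ) (f : ℕ → Edge Q Γ) : ℝ :=
  Filter.liminf (avgPref A f) Filter.atTop

/-- An infinite edge sequence is ultimately periodic. -/
def UltPeriodic (f : ℕ → Edge Q Γ) : Prop :=
  ∃ N p : ℕ, 0 < p ∧ ∀ n, N ≤ n → f (n + p) = f n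

/-- The infinite path `(c, f)` is stack bounded. -/
def StackBounded (c : Config Q Γ) (f : ℕ → Edge Q Γ) : Prop :=
  ∃ n : ℕ, ∀ k, height (confs c f k) ≤ n

/-- Non-decreasing path: a valid path whose first configuration is a local minima. -/
def WPS.NonDec (A : WPS Q Γ) (c : Config Q Γ) (es : List (Edge Q Γ)) : Prop :=
  A.Valid c es ∧ FirstMin c es

/-- Summary function, valued in `EReal`: `⊥` means there is no non-decreasing path
from `(⊥γ,q₁)` to `(⊥γ,q₂)`, `⊤` means `ω` (weights unbounded from above), and
otherwise the value is the maximal weight of such a path. -/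
noncomputable def WPS.summary (A : WPS Q Γ) (q₁ : Q) (γ : Γ) (q₂ : Q) : EReal :=
  sSup { x : EReal | ∃ es, A.NonDec ([γ, A.bot], q₁) es ∧
    endc ([γ, A.bot], q₁) es = ([γ, A.bot], q₂) ∧ x = ((A.wt es : ℝ) : EReal) }

/-- Stack height bounded summary function: as `summary` but only over non-decreasing
paths of additional stack height at most `d`. -/
noncomputable def WPS.summaryBdd (A : WPS Q Γ) (d : ℕ) (q₁ : Q) (γ : Γ) (q₂ : Q) : EReal :=
  sSup { x : EReal | ∃ es, A.NonDec ([γ, A.bot], q₁) es ∧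
    endc ([γ, A.bot], q₁) es = ([γ, A.bot], q₂) ∧ ASH ([γ, A.bot], q₁) es ≤ d ∧
    x = ((A.wt es : ℝ) : EReal) }

/-- Edges of the summary graph `Gr(A)` together with their weights in `EReal`
(`⊤` plays the role of `ω`): skip edges weighted by the summary function and push
edges weighted by the corresponding transition weight. -/
def WPS.GrEdge (A : WPS Q Γ) (v₁ v₂ : Q × Γ) (x : EReal) : Prop :=
  (v₁.2 = v₂.2 ∧ A.summary v₁.1 v₁.2 v₂.1 ≠ ⊥ ∧ x = A.summary v₁.1 v₁.2 v₂.1) ∨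
  (∃ e ∈ A.E, e.q1 = v₁.1 ∧ e.top = v₁.2 ∧ e.q2 = v₂.1 ∧ e.com = Com.push v₂.2 ∧
    x = ((A.w e : ℝ) : EReal))

/-- The summary graph `Gr(A)` has a positive simple cycle: a simple cycle containing
an `ω`-edge or whose total weight is positive. -/
def WPS.PosSimpleCycle (A : WPS Q Γ) : Prop :=
  ∃ (k : ℕ) (v : Fin (k + 1) → Q × Γ) (x : Fin (k + 1) → EReal),
    Function.Injective v ∧ (∀ i, A.GrEdge (v i) (v (i + 1)) (x i)) ∧
    ((∃ i, x i = ⊤) ∨ (0 : EReal) < ∑ i, x i)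

/-- Weight of a finite path under the shifted weight function `w + r`. -/
def WPS.wtQ (A : WPS Q Γ) (r : ℚ) (es : List (Edge Q Γ)) : ℚ :=
  (es.map (fun e => (A.w e : ℚ) + r)).sum

/-- The shifted system `A^r` (weight function `w + r`) has a good cycle. -/
def WPS.GoodCycleShift (A : WPS Q Γ) (r : ℚ) : Prop :=
  ∃ c es, IsConfig c ∧ A.Valid c es ∧ 0 < A.wtQ r es ∧ FirstMin c es ∧
    (endc c es).2 = c.2 ∧ (endc c es).1.head? = c.1.head?

end PDS

namespace PDS

/-- `A.LevelRun q γ q' es H`: the edge sequence `es` leads from state `q` with top symbol `γ` back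
to the same stack in state `q'`, never touching the stack below, and rising at most `H` above its
initial height. -/
inductive WPS.LevelRun {Q Γ : Type} (A : WPS Q Γ) : Q → Γ → Q → List (Edge Q Γ) → ℕ → Prop
  | nil (q : Q) (γ : Γ) : A.LevelRun q γ q [] 0
  | skip {q' : Q} {es : List (Edge Q Γ)} {H : ℕ} (e : Edge Q Γ) (he : e ∈ A.E)
      (hc : e.com = Com.skip) (hr : A.LevelRun e.q2 e.top q' es H) :
      A.LevelRun e.q1 e.top q' (e :: es) H
  | push {q' : Q} {es₁ es₂ : List (Edge Q Γ)} {H₁ H₂ : ℕ} (e e' : Edge Q Γ) (he : e ∈ A.E)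
      (hc : e.com = Com.push e'.top) (he' : e' ∈ A.E) (hc' : e'.com = Com.pop)
      (h₁ : A.LevelRun e.q2 e'.top e'.q1 es₁ H₁) (h₂ : A.LevelRun e'.q2 e.top q' es₂ H₂) :
      A.LevelRun e.q1 e.top q' (e :: es₁ ++ e' :: es₂) (max (H₁ + 1) H₂)

/-- A level run of some height between the states of a triple `(q, γ, q')`. -/
def WPS.HasLevelRun {Q Γ : Type} (A : WPS Q Γ) (t : Q × Γ × Q) (es : List (Edge Q Γ)) : Prop :=
  ∃ H, A.LevelRun t.1 t.2.1 t.2.2 es H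

/-- `(u, x)` is a context that turns level runs for `t'` into level runs for `t`. -/
def WPS.RunContext {Q Γ : Type} (A : WPS Q Γ) (t t' : Q × Γ × Q) (u x : List (Edge Q Γ)) : Prop :=
  ∀ es, A.HasLevelRun t' es → A.HasLevelRun t (u ++ es ++ x)

/-- The edge sequence `s'` sits inside `s`, in a context for their triples. -/
def WPS.Nested {Q Γ : Type} (A : WPS Q Γ) (s s' : (Q × Γ × Q) × List (Edge Q Γ)) : Prop :=
  ∃ u x, s.2 = u ++ s'.2 ++ x ∧ A.RunContext s.1 s'.1 u x

section
variable {Q Γ : Type} {A : WPS Q Γ}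

theorem WPS.wt_append (A : WPS Q Γ) (es es' : List (Edge Q Γ)) :
    A.wt (es ++ es') = A.wt es + A.wt es' := by
  simp [WPS.wt]

theorem endc_append (c : Config Q Γ) (es es' : List (Edge Q Γ)) :
    endc c (es ++ es') = endc (endc c es) es' := by
  simp [endc]

theorem mem_trace_cons {c c' : Config Q Γ} {e : Edge Q Γ} {es : List (Edge Q Γ)} :
    c' ∈ trace c (e :: es) ↔ c' = c ∨ c' ∈ trace (next c e) es := by
  simp [trace, List.scanl_cons]

theorem mem_trace_nil {c c' : Config Q Γ} : c' ∈ trace c ([] : List (Edge Q Γ)) ↔ c' = c := by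
  simp [trace]

theorem mem_trace_append {c c' : Config Q Γ} {es es' : List (Edge Q Γ)}
    (h : c' ∈ trace c (es ++ es')) : c' ∈ trace c es ∨ c' ∈ trace (endc c es) es' := by
  induction es generalizing c with
  | nil => exact Or.inr h
  | cons e es ih =>
    rw [List.cons_append, mem_trace_cons] at h
    rw [mem_trace_cons]
    rcases h with h | h
    · exact Or.inl (Or.inl h)
    · rcases ih h with h | h
      · exact Or.inl (Or.inr h)
      · exact Or.inr h

theorem WPS.valid_append {c : Config Q Γ} {es es' : List (Edge Q Γ)}
    (h : A.Valid c es) (h' : A.Valid (endc c es) es') : A.Valid c (es ++ es') := by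
  induction es generalizing c with
  | nil => exact h'
  | cons e es ih => exact ⟨h.1, ih h.2 h'⟩

theorem SH_le {c : Config Q Γ} {es : List (Edge Q Γ)} {m : ℕ}
    (h : ∀ c' ∈ trace c es, height c' ≤ m) : SH c es ≤ m := by
  unfold SH
  generalize trace c es = l at h
  induction l with
  | nil => simp
  | cons a l ih =>
    simp only [List.map_cons, List.foldr_cons, max_le_iff]
    exact ⟨h a (by simp), ih fun c' hc' => h c' (by simp [hc'])⟩

theorem WPS.LevelRun.valid_endc_trace {q q' : Q} {γ : Γ} {es : List (Edge Q Γ)} {H : ℕ}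
    (h : A.LevelRun q γ q' es H) (α : List Γ) :
    A.Valid (γ :: α, q) es ∧ endc (γ :: α, q) es = (γ :: α, q') ∧
      ∀ c' ∈ trace (γ :: α, q) es, γ :: α <:+ c'.1 ∧ height c' ≤ α.length + 1 + H := by
  induction h generalizing α with
  | nil q γ =>
    refine ⟨trivial, rfl, fun c' hc' => ?_⟩
    rw [mem_trace_nil] at hc'
    subst hc'
    simp [height]
  | @skip q' es H e he hc hr ih =>
    have hn : next (e.top :: α, e.q1) e = (e.top :: α, e.q2) := by simp [next, hc, Com.apply]
    obtain ⟨hv, hend, htr⟩ := ih α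
    refine ⟨⟨⟨he, rfl, rfl⟩, hn ▸ hv⟩, ?_, fun c' hc' => ?_⟩
    · rw [← hend, ← hn]; rfl
    · rw [mem_trace_cons, hn] at hc'
      rcases hc' with rfl | hc'
      · simp [height]
      · exact htr c' hc'
  | @push q' es₁ es₂ H₁ H₂ e e' he hc he' hc' h₁ h₂ ih₁ ih₂ =>
    have hn : next (e.top :: α, e.q1) e = (e'.top :: e.top :: α, e.q2) := by
      simp [next, hc, Com.apply]
    have hn' : next (e'.top :: e.top :: α, e'.q1) e' = (e.top :: α, e'.q2) := by
      simp [next, hc', Com.apply]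
    obtain ⟨hv₁, hend₁, htr₁⟩ := ih₁ (e.top :: α)
    obtain ⟨hv₂, hend₂, htr₂⟩ := ih₂ α
    refine ⟨⟨⟨he, rfl, rfl⟩, ?_⟩, ?_, fun c' hc' => ?_⟩
    · rw [hn]
      exact WPS.valid_append hv₁ (by rw [hend₁]; exact ⟨⟨he', rfl, rfl⟩, hn' ▸ hv₂⟩)
    · change endc (next (e.top :: α, e.q1) e) (es₁ ++ e' :: es₂) = _
      rw [hn, endc_append, hend₁, ← hend₂, ← hn']; rfl
    · rw [List.cons_append, mem_trace_cons, hn] at hc'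
      rcases hc' with rfl | hc'
      · simp [height]
      · rcases mem_trace_append hc' with hc' | hc'
        · obtain ⟨hs, hh⟩ := htr₁ c' hc'
          refine ⟨(List.suffix_cons _ _).trans hs, hh.trans ?_⟩
          have := le_max_left (H₁ + 1) H₂
          simp only [List.length_cons]
          omega
        · rw [hend₁, mem_trace_cons, hn'] at hc'
          rcases hc' with rfl | hc'
          · refine ⟨List.suffix_cons _ _, ?_⟩
            have := le_max_left (H₁ + 1) H₂
            simp only [height, List.length_cons]
            omega
          · obtain ⟨hs, hh⟩ := htr₂ c' hc'
            exact ⟨hs, hh.trans (by have := le_max_right (H₁ + 1) H₂; omega)⟩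

end

/-- `A.Descent z σ q q' es`: the edge sequence `es` leads from state `q` with stack `z :: σ` to
state `q'` with only the lowest symbol of `z :: σ` left, as level runs separated by pops. -/
def WPS.Descent {Q Γ : Type} (A : WPS Q Γ) : Γ → List Γ → Q → Q → List (Edge Q Γ) → Prop
  | z, [], q, q', es => A.HasLevelRun (q, z, q') es
  | z, y :: σ, q, q', es => ∃ es₁ e es₂, es = es₁ ++ e :: es₂ ∧ e ∈ A.E ∧ e.com = Com.pop ∧
      e.top = z ∧ A.HasLevelRun (q, z, e.q1) es₁ ∧ A.Descent y σ e.q2 q' es₂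

section
variable {Q Γ : Type} {A : WPS Q Γ}

theorem WPS.Descent.prepend {z : Γ} {σ : List Γ} {p q q' : Q} {u es : List (Edge Q Γ)}
    (h : ∀ r es₁, A.HasLevelRun (q, z, r) es₁ → A.HasLevelRun (p, z, r) (u ++ es₁))
    (hd : A.Descent z σ q q' es) : A.Descent z σ p q' (u ++ es) := by
  cases σ with
  | nil => exact h _ _ hd
  | cons y σ =>
    obtain ⟨es₁, e, es₂, rfl, he, hc, ht, hr, hd⟩ := hd
    exact ⟨u ++ es₁, e, es₂, by simp, he, hc, ht, h _ _ hr, hd⟩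

theorem WPS.Valid.descent {es : List (Edge Q Γ)} {z : Γ} {σ α : List Γ} {q : Q}
    (hv : A.Valid (z :: σ ++ α, q) es)
    (htr : ∀ c' ∈ trace (z :: σ ++ α, q) es, α.length < height c')
    (hend : height (endc (z :: σ ++ α, q) es) = α.length + 1) :
    A.Descent z σ q (endc (z :: σ ++ α, q) es).2 es := by
  induction es generalizing z σ q with
  | nil =>
    have : σ = [] := by simpa [endc, height, add_assoc] using hend
    subst this
    exact ⟨0, .nil _ _⟩
  | cons e es ih =>
    obtain ⟨⟨he, hq, ht⟩, hv⟩ := hv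
    obtain rfl : q = e.q1 := hq
    obtain rfl : z = e.top := by simpa using ht
    have htr' : ∀ c' ∈ trace (next (e.top :: σ ++ α, e.q1) e) es, α.length < height c' :=
      fun c' hc' => htr c' (mem_trace_cons.2 (Or.inr hc'))
    change height (endc (next (e.top :: σ ++ α, e.q1) e) es) = _ at hend
    change A.Descent _ _ _ (endc (next (e.top :: σ ++ α, e.q1) e) es).2 _
    rcases hc : e.com with _ | _ | y
    · have hn : next (e.top :: σ ++ α, e.q1) e = (e.top :: σ ++ α, e.q2) := by
        simp [next, hc, Com.apply]
      rw [hn] at hv htr' hend ⊢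
      exact WPS.Descent.prepend (u := [e]) (fun r es₁ ⟨H, hr⟩ => ⟨H, .skip e he hc hr⟩)
        (ih hv htr' hend)
    · have hn : next (e.top :: σ ++ α, e.q1) e = (σ ++ α, e.q2) := by
        simp [next, hc, Com.apply]
      rw [hn] at hv htr' hend ⊢
      cases σ with
      | nil =>
        have := htr' (α, e.q2) (by cases es <;> simp [trace, List.scanl_cons])
        simp [height] at this
      | cons y σ => exact ⟨[], e, es, rfl, he, hc, rfl, ⟨0, .nil _ _⟩, ih hv htr' hend⟩
    · have hn : next (e.top :: σ ++ α, e.q1) e = (y :: (e.top :: σ) ++ α, e.q2) := by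
        simp [next, hc, Com.apply]
      rw [hn] at hv htr' hend ⊢
      have hd := ih hv htr' hend
      generalize (endc (y :: (e.top :: σ) ++ α, e.q2) es).2 = q' at hd ⊢
      obtain ⟨es₁, e', es₂, hes, he', hc', rfl, ⟨H₁, hr⟩, hd⟩ := hd
      have key := WPS.Descent.prepend (p := e.q1) (u := e :: es₁ ++ [e'])
        (fun r es₃ ⟨H₂, h₂⟩ => ⟨max (H₁ + 1) H₂, by
          simpa using WPS.LevelRun.push e e' he hc he' hc' hr h₂⟩) hd
      rw [hes]
      simpa using key

theorem WPS.NonDec.hasLevelRun {q q' : Q} {γ : Γ} {α : List Γ} {es : List (Edge Q Γ)}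
    (h : A.NonDec (γ :: α, q) es) (hend : endc (γ :: α, q) es = (γ :: α, q')) :
    A.HasLevelRun (q, γ, q') es := by
  have := WPS.Valid.descent (σ := []) h.1
    (fun c' hc' => by simpa [height, Nat.succ_le_iff] using (h.2 c' hc').length_le)
    (by simp [hend, height])
  simpa [hend, WPS.Descent] using this

theorem WPS.RunContext.trans {t₁ t₂ t₃ : Q × Γ × Q} {u x v y : List (Edge Q Γ)}
    (h : A.RunContext t₁ t₂ u x) (h' : A.RunContext t₂ t₃ v y) :
    A.RunContext t₁ t₃ (u ++ v) (y ++ x) := fun es hes => by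
  simpa using h _ (h' _ hes)

theorem WPS.Nested.refl (s : (Q × Γ × Q) × List (Edge Q Γ)) : A.Nested s s :=
  ⟨[], [], by simp, fun es hes => by simpa using hes⟩

theorem WPS.Nested.trans {s₁ s₂ s₃ : (Q × Γ × Q) × List (Edge Q Γ)}
    (h : A.Nested s₁ s₂) (h' : A.Nested s₂ s₃) : A.Nested s₁ s₃ := by
  obtain ⟨u, x, h₁, h₂⟩ := h
  obtain ⟨v, y, h₃, h₄⟩ := h'
  exact ⟨u ++ v, y ++ x, by simp [h₁, h₃], h₂.trans h₄⟩

theorem WPS.RunContext.iterate {t : Q × Γ × Q} {u x : List (Edge Q Γ)}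
    (h : A.RunContext t t u x) {es : List (Edge Q Γ)} (hes : A.HasLevelRun t es) (n : ℕ) :
    ∃ es', A.HasLevelRun t es' ∧ A.wt es' = A.wt es + n * (A.wt u + A.wt x) := by
  induction n with
  | zero => exact ⟨es, hes, by simp⟩
  | succ n ih =>
    obtain ⟨es', h₁, h₂⟩ := ih
    refine ⟨_, h _ h₁, ?_⟩
    rw [WPS.wt_append, WPS.wt_append, h₂]
    push_cast
    ring

theorem WPS.LevelRun.exists_nested {q q' : Q} {γ : Γ} {es : List (Edge Q Γ)} {H n : ℕ}
    (h : A.LevelRun q γ q' es H) (hH : H = n + 1) :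
    ∃ t' es', es'.length < es.length ∧ A.Nested ((q, γ, q'), es) (t', es') ∧
      A.LevelRun t'.1 t'.2.1 t'.2.2 es' n := by
  induction h with
  | nil => omega
  | @skip q' es H e he hc hr ih =>
    obtain ⟨t', es', hlt, hnest, hr'⟩ := ih hH
    have hout : A.Nested ((e.q1, e.top, q'), e :: es) ((e.q2, e.top, q'), es) :=
      ⟨[e], [], by simp, fun es₁ ⟨H, h₁⟩ => ⟨H, by simpa using .skip e he hc h₁⟩⟩
    exact ⟨t', es', hlt.trans (by simp), hout.trans hnest, hr'⟩
  | @push q' es₁ es₂ H₁ H₂ e e' he hc he' hc' h₁ h₂ ih₁ ih₂ =>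
    rcases max_choice (H₁ + 1) H₂ with hm | hm
    · obtain rfl : H₁ = n := by omega
      refine ⟨(e.q2, e'.top, e'.q1), es₁, by simp, ⟨[e], e' :: es₂, by simp, ?_⟩, h₁⟩
      exact fun es₃ ⟨H, h₃⟩ => ⟨_, by simpa using WPS.LevelRun.push e e' he hc he' hc' h₃ h₂⟩
    · obtain ⟨t', es', hlt, hnest, hr'⟩ := ih₂ (hm.symm.trans hH)
      have hout : A.Nested ((e.q1, e.top, q'), e :: es₁ ++ e' :: es₂) ((e'.q2, e.top, q'), es₂) :=
        ⟨e :: es₁ ++ [e'], [], by simp, fun es₃ ⟨H, h₃⟩ =>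
          ⟨_, by simpa using WPS.LevelRun.push e e' he hc he' hc' h₁ h₃⟩⟩
      exact ⟨t', es', hlt.trans (by simp; omega), hout.trans hnest, hr'⟩

theorem WPS.LevelRun.exists_chain {t : Q × Γ × Q} {es : List (Edge Q Γ)} {H : ℕ}
    (h : A.LevelRun t.1 t.2.1 t.2.2 es H) :
    ∃ f : ℕ → (Q × Γ × Q) × List (Edge Q Γ), f 0 = (t, es) ∧
      (∀ i ≤ H, A.HasLevelRun (f i).1 (f i).2) ∧
      ∀ i < H, (f (i + 1)).2.length < (f i).2.length ∧ A.Nested (f i) (f (i + 1)) := by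
  induction H generalizing t es with
  | zero =>
    refine ⟨fun _ => (t, es), rfl, fun _ _ => ⟨_, h⟩, fun i hi => by omega⟩
  | succ n ih =>
    obtain ⟨t', es', hlt, hnest, hr⟩ := h.exists_nested rfl
    obtain ⟨f, hf0, hfr, hfs⟩ := ih hr
    refine ⟨fun i => Nat.casesOn i (t, es) f, rfl, fun i hi => ?_, fun i hi => ?_⟩
    · cases i with
      | zero => exact ⟨_, h⟩
      | succ i => exact hfr i (by omega)
    · cases i with
      | zero => simpa [hf0] using ⟨hlt, hnest⟩
      | succ i => exact hfs i (by omega)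

theorem WPS.Nested.of_chain {f : ℕ → (Q × Γ × Q) × List (Edge Q Γ)} {H i j : ℕ}
    (hf : ∀ i < H, (f (i + 1)).2.length < (f i).2.length ∧ A.Nested (f i) (f (i + 1)))
    (hij : i ≤ j) (hj : j ≤ H) :
    (f j).2.length + (j - i) ≤ (f i).2.length ∧ A.Nested (f i) (f j) := by
  induction j, hij using Nat.le_induction with
  | base => exact ⟨by simp, .refl _⟩
  | succ j hij ih =>
    obtain ⟨h₁, h₂⟩ := ih (by omega)
    obtain ⟨h₃, h₄⟩ := hf j (by omega)
    exact ⟨by omega, h₂.trans h₄⟩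

/-- A level run higher than the number of triples contains a removable and repeatable pair of
segments. -/
theorem WPS.LevelRun.exists_pump [Fintype Q] [Fintype Γ] {t : Q × Γ × Q}
    {es : List (Edge Q Γ)} {H : ℕ} (h : A.LevelRun t.1 t.2.1 t.2.2 es H)
    (hH : Fintype.card (Q × Γ × Q) ≤ H) :
    ∃ t' u p₁ v p₂ x, es = u ++ (p₁ ++ v ++ p₂) ++ x ∧ 0 < p₁.length + p₂.length ∧
      A.HasLevelRun t' v ∧ A.RunContext t' t' p₁ p₂ ∧ A.RunContext t t' u x := by
  obtain ⟨f, hf0, hfr, hfs⟩ := h.exists_chain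
  obtain ⟨i, j, hij, hf⟩ : ∃ i j : Fin (H + 1), i < j ∧ (f i).1 = (f j).1 := by
    obtain ⟨i, j, hne, hf⟩ := Fintype.exists_ne_map_eq_of_card_lt
      (fun i : Fin (H + 1) => (f i).1) (by rw [Fintype.card_fin]; omega)
    rcases lt_or_gt_of_ne hne with h | h
    · exact ⟨i, j, h, hf⟩
    · exact ⟨j, i, h, hf.symm⟩
  have hij' : (i : ℕ) < j := hij
  obtain ⟨_, u, x, hes, hux⟩ := WPS.Nested.of_chain hfs (Nat.zero_le (i : ℕ)) (by omega)
  obtain ⟨hlen, p₁, p₂, hes', hp⟩ := WPS.Nested.of_chain hfs hij'.le (by omega)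
  rw [hf0] at hes hux
  refine ⟨(f j).1, u, p₁, (f j).2, p₂, x, ?_, ?_, hfr j (by omega), ?_, ?_⟩
  · rw [← hes', ← hes]
  · rw [hes'] at hlen
    simp only [List.length_append] at hlen
    omega
  · exact hf ▸ hp
  · exact hf ▸ hux

theorem WPS.HasLevelRun.exists_bounded [Fintype Q] [Fintype Γ] {t : Q × Γ × Q}
    {es : List (Edge Q Γ)} (hes : A.HasLevelRun t es) {B : ℤ}
    (hB : ∀ es, A.HasLevelRun t es → A.wt es ≤ B) :
    ∃ es' H, A.LevelRun t.1 t.2.1 t.2.2 es' H ∧ H < Fintype.card (Q × Γ × Q) ∧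
      A.wt es ≤ A.wt es' := by
  induction hn : es.length using Nat.strong_induction_on generalizing es with
  | _ n ih =>
    obtain ⟨H, hr⟩ := hes
    rcases lt_or_ge H (Fintype.card (Q × Γ × Q)) with hlt | hge
    · exact ⟨es, H, hr, hlt, le_rfl⟩
    · obtain ⟨t', u, p₁, v, p₂, x, rfl, hpos, hv, hp, hux⟩ := hr.exists_pump hge
      have hle : A.wt p₁ + A.wt p₂ ≤ 0 := by
        by_contra! hgt
        obtain ⟨es', h₁, h₂⟩ :=
          hp.iterate hv (B + 1 - (A.wt u + A.wt v + A.wt x)).toNat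
        have h₃ := hB _ (hux _ h₁)
        rw [WPS.wt_append, WPS.wt_append, h₂] at h₃
        have h₄ := Int.self_le_toNat (B + 1 - (A.wt u + A.wt v + A.wt x))
        nlinarith
      obtain ⟨es', H', h₁, h₂, h₃⟩ := ih _ (by
        rw [← hn]
        simp only [List.length_append]
        omega) (hux v hv) rfl
      refine ⟨es', H', h₁, h₂, le_trans ?_ h₃⟩
      simp only [WPS.wt_append]
      linarith

theorem WPS.LevelRun.nonDec {q q' : Q} {γ : Γ} {es : List (Edge Q Γ)} {H : ℕ}
    (h : A.LevelRun q γ q' es H) (α : List Γ) : A.NonDec (γ :: α, q) es :=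
  ⟨(h.valid_endc_trace α).1, fun c' hc' => ((h.valid_endc_trace α).2.2 c' hc').1⟩

theorem WPS.LevelRun.ASH_le {q q' : Q} {γ : Γ} {es : List (Edge Q Γ)} {H : ℕ}
    (h : A.LevelRun q γ q' es H) (α : List Γ) : ASH (γ :: α, q) es ≤ H := by
  have hS := SH_le fun c' hc' => ((h.valid_endc_trace α).2.2 c' hc').2
  rw [ASH, (h.valid_endc_trace α).2.1]
  simp only [height, List.length_cons, max_self]
  omega

theorem WPS.exists_wt_le_of_summary_ne_top {q q' : Q} {γ : Γ} (h : A.summary q γ q' ≠ ⊤) :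
    ∃ B : ℤ, ∀ es, A.HasLevelRun (q, γ, q') es → A.wt es ≤ B := by
  by_contra! hB
  refine h (EReal.eq_top_iff_forall_lt _ |>.2 fun y => ?_)
  obtain ⟨es, ⟨H, hr⟩, hlt⟩ := hB ⌈y⌉
  refine lt_of_lt_of_le ?_
    (le_sSup ⟨es, hr.nonDec [A.bot], (hr.valid_endc_trace [A.bot]).2.1, rfl⟩)
  exact_mod_cast (Int.le_ceil y).trans_lt (by exact_mod_cast hlt)

end

end PDS

open PDS in
/-- if the summary function value is not `ω` (i.e. not `⊤`), then it
coincides with the stack-height-bounded summary function for bound `d = (|Q|·|Γ|)²`. -/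
theorem summary_eq_bounded_summary_when_not_omega
    {Q Γ : Type} [Fintype Q] [Fintype Γ] (A : WPS Q Γ)
    (q₁ q₂ : Q) (γ : Γ)
    (h : A.summary q₁ γ q₂ ≠ ⊤) :
    A.summary q₁ γ q₂ =
      A.summaryBdd ((Fintype.card Q * Fintype.card Γ) ^ 2) q₁ γ q₂ := by
  have : Nonempty Γ := ⟨γ⟩
  have hcard : Fintype.card (Q × Γ × Q) ≤ (Fintype.card Q * Fintype.card Γ) ^ 2 := by
    rw [Fintype.card_prod, Fintype.card_prod, mul_pow, sq, sq]
    have h1 : 1 ≤ Fintype.card Γ := Fintype.card_pos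
    have h2 := Nat.mul_le_mul_left (Fintype.card Q * Fintype.card Q)
      (Nat.le_mul_of_pos_left (Fintype.card Γ) h1)
    linarith
  obtain ⟨B, hB⟩ := WPS.exists_wt_le_of_summary_ne_top h
  apply le_antisymm
  · refine sSup_le ?_
    rintro _ ⟨es, hnd, hend, rfl⟩
    obtain ⟨es', H, hr, hH, hle⟩ := (hnd.hasLevelRun hend).exists_bounded hB
    refine le_trans ?_ (le_sSup ⟨es', hr.nonDec [A.bot], (hr.valid_endc_trace [A.bot]).2.1,
      (hr.ASH_le [A.bot]).trans (hH.le.trans hcard), rfl⟩)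
    exact_mod_cast hle
  · refine sSup_le_sSup ?_
    rintro x ⟨es, hnd, hend, -, hx⟩
    exact ⟨es, hnd, hend, hx⟩
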